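/- arXiv:1208.4013 — 2 statements merged into one kernel-verified Lean document; each statement's English description precedes it below -/
import Mathlib

section
/- Let A be an n×n real symmetric positive semidefinite matrix, b, δ, b' reals with δ > 0, b' = b − δ, b' ≥ δ, assume every nonzero eigenvalue of A is greater than b, and let L be an n×n real matrix with Tr[Lᵀ(A − bI)⁻¹L] ≤ −n − 2‖L‖²/δ. Then Tr[Lᵀ(A − b'I)⁻¹L Lᵀ(A − b'I)⁻¹L] ≤ (Tr[Lᵀ(A − bI)⁻¹L] − Tr[Lᵀ(A − b'I)⁻¹L]) · (−n − Tr[Lᵀ(A − b'I)⁻¹L]). -/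
open Matrix

/-- A shifted resolvent of a Hermitian matrix in its eigenbasis. -/
lemma Matrix.IsHermitian.inv_sub_smul_one {n : Type*} [Fintype n] [DecidableEq n]
    {A : Matrix n n ℝ} (hA : A.IsHermitian) {c : ℝ} (hc : ∀ i, hA.eigenvalues i ≠ c) :
    (A - c • 1)⁻¹ = Unitary.conjStarAlgAut ℝ _ hA.eigenvectorUnitary
      (diagonal fun i => (hA.eigenvalues i - c)⁻¹) := by
  apply Matrix.inv_eq_right_inv
  set φ := Unitary.conjStarAlgAut ℝ _ hA.eigenvectorUnitary with hφ
  have hshift : A - c • 1 = φ (diagonal fun i => hA.eigenvalues i - c) := by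
    have hdiag : (diagonal fun i => hA.eigenvalues i - c) =
        diagonal (RCLike.ofReal ∘ hA.eigenvalues) - c • (1 : Matrix n n ℝ) := by
      rw [smul_one_eq_diagonal, diagonal_sub]
      rfl
    rw [hdiag, map_sub, map_smul, map_one, hφ, ← hA.spectral_theorem]
  rw [hshift, ← map_mul, diagonal_mul_diagonal, ← map_one φ, ← diagonal_one]
  congr 2
  ext i
  exact mul_inv_cancel₀ (sub_ne_zero.mpr (hc i))

/-- `L Lᵀ ≤ ‖L‖² I` in the Loewner order. -/
lemma Matrix.posSemidef_sq_opNorm_smul_one_sub_mul_transpose {n : Type*} [Fintype n]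
    [DecidableEq n] (L : Matrix n n ℝ) :
    (‖toEuclideanCLM (𝕜 := ℝ) L‖ ^ 2 • (1 : Matrix n n ℝ) - L * Lᵀ).PosSemidef := by
  refine .of_dotProduct_mulVec_nonneg ?_ fun x => ?_
  · refine (isHermitian_one.smul (IsSelfAdjoint.all _)).sub ?_
    simpa using isHermitian_mul_conjTranspose_self L
  · have hnorm : ‖toEuclideanCLM (𝕜 := ℝ) Lᵀ‖ = ‖toEuclideanCLM (𝕜 := ℝ) L‖ := by
      rw [← conjTranspose_eq_transpose_of_trivial]
      exact l2_opNorm_conjTranspose L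
    have hle := (toEuclideanCLM (𝕜 := ℝ) Lᵀ).le_opNorm (WithLp.toLp 2 x)
    rw [hnorm, toEuclideanCLM_toLp] at hle
    have hsq := pow_le_pow_left₀ (norm_nonneg _) hle 2
    have hdot (y : n → ℝ) : ‖WithLp.toLp 2 y‖ ^ 2 = y ⬝ᵥ y := by
      rw [EuclideanSpace.norm_sq_eq]
      simp [dotProduct, sq]
    rw [mul_pow, hdot, hdot] at hsq
    have hquad : x ⬝ᵥ (L * Lᵀ) *ᵥ x = (Lᵀ *ᵥ x) ⬝ᵥ (Lᵀ *ᵥ x) := by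
      rw [← mulVec_mulVec, dotProduct_mulVec, mulVec_transpose]
    rw [star_trivial, sub_mulVec, smul_mulVec, one_mulVec, dotProduct_sub, dotProduct_smul,
      hquad, smul_eq_mul]
    linarith

lemma inv_sub_inv_sub_half_mul_sq_nonneg {x b δ : ℝ} (hδ : 0 < δ) (hb : δ ≤ b - δ)
    (hx : x = 0 ∨ b < x) :
    0 ≤ (x - b)⁻¹ - (x - (b - δ))⁻¹ - δ / 2 * ((x - (b - δ))⁻¹ * (x - (b - δ))⁻¹) := by
  have hxb : x - b ≠ 0 := by rcases hx with rfl | hx <;> intro h <;> linarith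
  have hxb' : x - (b - δ) ≠ 0 := by rcases hx with rfl | hx <;> intro h <;> linarith
  have heq : (x - b)⁻¹ - (x - (b - δ))⁻¹ - δ / 2 * ((x - (b - δ))⁻¹ * (x - (b - δ))⁻¹) =
      δ / 2 * ((x - b + 2 * δ) / (x - b)) * ((x - (b - δ))⁻¹) ^ 2 := by
    field_simp
    ring
  have hquot : 0 ≤ (x - b + 2 * δ) / (x - b) := by
    rcases hx with rfl | hx
    · exact div_nonneg_of_nonpos (by linarith) (by linarith)
    · exact div_nonneg (by linarith) (by linarith)
  rw [heq]
  positivity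

/-- Step 3 — the key trace product bound. -/
theorem step_three_trace_product_bound
    (n : ℕ) (A : Matrix (Fin n) (Fin n) ℝ) (hA : A.PosSemidef)
    (b δ b' : ℝ) (hδ : 0 < δ) (hb' : b' = b - δ) (hδb' : δ ≤ b')
    (heig : ∀ i : Fin n, hA.isHermitian.eigenvalues i ≠ 0 → b < hA.isHermitian.eigenvalues i)
    (L : Matrix (Fin n) (Fin n) ℝ)
    (htr : (Lᵀ * (A - b • 1)⁻¹ * L).trace ≤
      -(n : ℝ) - 2 * ‖Matrix.toEuclideanCLM (𝕜 := ℝ) L‖ ^ 2 / δ) :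
    (Lᵀ * (A - b' • 1)⁻¹ * L * Lᵀ * (A - b' • 1)⁻¹ * L).trace ≤
      ((Lᵀ * (A - b • 1)⁻¹ * L).trace - (Lᵀ * (A - b' • 1)⁻¹ * L).trace) *
        (-(n : ℝ) - (Lᵀ * (A - b' • 1)⁻¹ * L).trace) := by
  subst hb'
  have hcases (i : Fin n) : hA.isHermitian.eigenvalues i = 0 ∨
      b < hA.isHermitian.eigenvalues i := or_iff_not_imp_left.mpr (heig i)
  have hX := hA.isHermitian.inv_sub_smul_one (c := b)
    fun i h => by rcases hcases i with h' | h' <;> linarith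
  have hY := hA.isHermitian.inv_sub_smul_one (c := b - δ)
    fun i h => by rcases hcases i with h' | h' <;> linarith
  set X := (A - b • 1)⁻¹
  set Y := (A - (b - δ) • 1)⁻¹
  set s := ‖toEuclideanCLM (𝕜 := ℝ) L‖ ^ 2
  have hYT : Yᵀ = Y := by
    rw [← conjTranspose_eq_transpose_of_trivial, ← star_eq_conjTranspose, hY, ← map_star,
      star_eq_conjTranspose, diagonal_conjTranspose, star_trivial]
  have hpsd : (X - Y - (δ / 2) • (Y * Y)).PosSemidef := by
    rw [hX, hY, ← map_mul, ← map_smul, ← map_sub, ← map_sub, Unitary.conjStarAlgAut_apply,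
      star_eq_conjTranspose]
    apply PosSemidef.mul_mul_conjTranspose_same
    rw [diagonal_mul_diagonal, ← diagonal_smul, diagonal_sub, diagonal_sub,
      posSemidef_diagonal_iff]
    exact fun i => inv_sub_inv_sub_half_mul_sq_nonneg hδ hδb' (hcases i)
  have hdiff := (hpsd.conjTranspose_mul_mul_same L).trace_nonneg
  have hbound := ((posSemidef_sq_opNorm_smul_one_sub_mul_transpose L).conjTranspose_mul_mul_same
    (Y * L)).trace_nonneg
  have hsq := (posSemidef_conjTranspose_mul_self (Y * L)).trace_nonneg
  simp only [conjTranspose_eq_transpose_of_trivial, transpose_mul, hYT, Matrix.mul_sub,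
    Matrix.sub_mul, trace_sub, Matrix.mul_smul, Matrix.smul_mul, trace_smul, Matrix.mul_one,
    smul_eq_mul, ← Matrix.mul_assoc] at hdiff hbound hsq ⊢
  set q := (Lᵀ * Y * Y * L).trace
  set T := (Lᵀ * X * L).trace
  set T' := (Lᵀ * Y * L).trace
  have hs : 0 ≤ s := sq_nonneg _
  have hTT' : 0 ≤ T - T' := by nlinarith
  have hfactor : 2 * s / δ ≤ -(n : ℝ) - T' := by linarith
  calc _ ≤ s * q := by linarith
    _ = 2 * s / δ * (δ / 2 * q) := by field_simp
    _ ≤ 2 * s / δ * (T - T') := by gcongr; linarith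
    _ ≤ (-(n : ℝ) - T') * (T - T') := by gcongr
    _ = _ := mul_comm _ _
end

section
/- Let A be an n×n real symmetric positive semidefinite matrix and b' > 0 a real number such that every nonzero eigenvalue of A is greater than b'. Then A − b'I is invertible, and for every vector x in the column space (range) of A, xᵀ(A − b'I)⁻¹x ≥ 0. -/
open Matrix

section OrthogonalDiagonalization

variable {n : Type*} [Fintype n] [DecidableEq n] {U : Matrix n n ℝ} {d : n → ℝ} {b : ℝ}

/-- Shifting an orthogonally diagonalized matrix by a scalar shifts its diagonal part. -/
theorem conj_diagonal_sub_smul_one (hU : U * Uᵀ = 1) :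
    U * diagonal d * Uᵀ - b • (1 : Matrix n n ℝ) = U * diagonal (fun i => d i - b) * Uᵀ := by
  have hd : diagonal (fun i => d i - b) = diagonal d - b • (1 : Matrix n n ℝ) := by
    rw [smul_one_eq_diagonal, diagonal_sub]
  rw [hd, Matrix.mul_sub, Matrix.sub_mul, Matrix.mul_smul, Matrix.smul_mul, Matrix.mul_one, hU]

theorem conj_diagonal_sub_smul_one_mul_conj_diagonal_inv (hU : U * Uᵀ = 1)
    (hd : ∀ i, d i ≠ b) :
    (U * diagonal d * Uᵀ - b • (1 : Matrix n n ℝ)) *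
      (U * diagonal (fun i => (d i - b)⁻¹) * Uᵀ) = 1 := by
  have hU' : Uᵀ * U = 1 := mul_eq_one_comm.mp hU
  have hdiag : diagonal (fun i => d i - b) * diagonal (fun i => (d i - b)⁻¹) = 1 := by
    rw [diagonal_mul_diagonal, ← diagonal_one]
    congr 1
    funext i
    exact mul_inv_cancel₀ (sub_ne_zero.mpr (hd i))
  calc _ = U * diagonal (fun i => d i - b) * (Uᵀ * U) *
        diagonal (fun i => (d i - b)⁻¹) * Uᵀ := by
        rw [conj_diagonal_sub_smul_one hU]; simp only [Matrix.mul_assoc]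
    _ = 1 := by
        rw [hU', Matrix.mul_one, Matrix.mul_assoc U, hdiag, Matrix.mul_one, hU]

/-- In orthogonal coordinates, the quadratic form of a diagonalized matrix evaluated on the image
of another matrix diagonalized by the same basis is a weighted sum of squares. -/
theorem conj_diagonal_quadratic_form_range (hU : U * Uᵀ = 1) (e : n → ℝ) (y : n → ℝ) :
    ((U * diagonal d * Uᵀ) *ᵥ y) ⬝ᵥ
        ((U * diagonal e * Uᵀ) *ᵥ ((U * diagonal d * Uᵀ) *ᵥ y)) =
      ∑ i, e i * (d i * (Uᵀ *ᵥ y) i) ^ 2 := by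
  have hU' : Uᵀ * U = 1 := mul_eq_one_comm.mp hU
  have hcancel (v : n → ℝ) : Uᵀ *ᵥ (U *ᵥ v) = v := by
    rw [mulVec_mulVec, hU', one_mulVec]
  have hdot (v w : n → ℝ) : (U *ᵥ v) ⬝ᵥ (U *ᵥ w) = v ⬝ᵥ w := by
    rw [dotProduct_mulVec, ← mulVec_transpose, hcancel]
  simp only [← mulVec_mulVec, hcancel, hdot]
  simp only [dotProduct, mulVec_diagonal]
  exact Finset.sum_congr rfl fun i _ => by ring

end OrthogonalDiagonalization

/-- `(A − b'I)⁻¹` is invertible and its quadratic form is nonnegative on the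
column space of `A`. -/
theorem quadratic_form_nonneg_on_range
    (n : ℕ) (A : Matrix (Fin n) (Fin n) ℝ) (hA : A.PosSemidef)
    (b' : ℝ) (hb' : 0 < b')
    (heig : ∀ i : Fin n, hA.isHermitian.eigenvalues i ≠ 0 → b' < hA.isHermitian.eigenvalues i) :
    IsUnit (A - b' • 1).det ∧
      ∀ x : Fin n → ℝ, (∃ y : Fin n → ℝ, x = A *ᵥ y) →
        0 ≤ x ⬝ᵥ ((A - b' • 1)⁻¹ *ᵥ x) := by
  obtain ⟨U, hU, hspec⟩ : ∃ U : Matrix (Fin n) (Fin n) ℝ, U * Uᵀ = 1 ∧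
      A = U * diagonal hA.isHermitian.eigenvalues * Uᵀ := by
    refine ⟨hA.isHermitian.eigenvectorUnitary,
      Unitary.coe_mul_star_self hA.isHermitian.eigenvectorUnitary, ?_⟩
    exact hA.isHermitian.spectral_theorem
  generalize hA.isHermitian.eigenvalues = d at heig hspec
  subst hspec
  have hd : ∀ i, d i ≠ b' := fun i h => (heig i (h ▸ hb'.ne')).ne' h
  have hinv := conj_diagonal_sub_smul_one_mul_conj_diagonal_inv hU hd
  refine ⟨(isUnit_iff_isUnit_det _).mp (IsUnit.of_mul_eq_one _ hinv), ?_⟩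
  rintro _ ⟨y, rfl⟩
  rw [inv_eq_right_inv hinv, conj_diagonal_quadratic_form_range hU]
  refine Finset.sum_nonneg fun i _ => ?_
  by_cases h0 : d i = 0
  · simp [h0]
  · exact mul_nonneg (inv_nonneg.mpr (sub_nonneg.mpr (heig i h0).le)) (sq_nonneg _)
end
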